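/- arXiv:1109.1337 — 2 statements merged into one kernel-verified Lean document; each statement's English description precedes it below -/
import Mathlib

section
/- Let Γ be the group of the tomotope, i.e., the group presented by generators ρ_0, ρ_1, ρ_2, ρ_3 subject to ρ_i² = (ρ_0ρ_2)² = (ρ_0ρ_3)² = (ρ_2ρ_3)² = (ρ_0ρ_1)³ = (ρ_1ρ_2)³ = (ρ_1ρ_3)⁴ = (ρ_0ρ_1ρ_3)³ = (ρ_2ρ_1ρ_3)³ = 1. Then Γ satisfies the intersection condition: for all subsets I, J of the four-element index set of the generators ρ_0, ρ_1, ρ_2, ρ_3, one has ⟨I⟩ ∩ ⟨J⟩ = ⟨I ∩ J⟩ as subgroups of Γ. -/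
namespace Tomotope

/-- The generator `ρ i` of the free group on four letters. -/
def ρ (i : Fin 4) : FreeGroup (Fin 4) := FreeGroup.of i

/-- The relators of the tomotope group. -/
def tomotopeRels : Set (FreeGroup (Fin 4)) :=
  {ρ 0 ^ 2, ρ 1 ^ 2, ρ 2 ^ 2, ρ 3 ^ 2,
   (ρ 0 * ρ 2) ^ 2, (ρ 0 * ρ 3) ^ 2, (ρ 2 * ρ 3) ^ 2,
   (ρ 0 * ρ 1) ^ 3, (ρ 1 * ρ 2) ^ 3, (ρ 1 * ρ 3) ^ 4,
   (ρ 0 * ρ 1 * ρ 3) ^ 3, (ρ 2 * ρ 1 * ρ 3) ^ 3}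

theorem forall_mem_tomotopeRels {P : FreeGroup (Fin 4) → Prop} :
    (∀ r ∈ tomotopeRels, P r) ↔
      P (ρ 0 ^ 2) ∧ P (ρ 1 ^ 2) ∧ P (ρ 2 ^ 2) ∧ P (ρ 3 ^ 2) ∧
      P ((ρ 0 * ρ 2) ^ 2) ∧ P ((ρ 0 * ρ 3) ^ 2) ∧ P ((ρ 2 * ρ 3) ^ 2) ∧
      P ((ρ 0 * ρ 1) ^ 3) ∧ P ((ρ 1 * ρ 2) ^ 3) ∧ P ((ρ 1 * ρ 3) ^ 4) ∧
      P ((ρ 0 * ρ 1 * ρ 3) ^ 3) ∧ P ((ρ 2 * ρ 1 * ρ 3) ^ 3) := by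
  simp only [tomotopeRels, Set.mem_insert_iff, Set.mem_singleton_iff, forall_eq_or_imp, forall_eq]

/-- The consequences of the relations among three involutions `a`, `b`, `c` in which `a` and `c`
commute, `a * b` has order dividing `3`, `b * c` has order dividing `4` and `a * b * c` has order
dividing `3`. -/
theorem rewriting_identities {G : Type*} [Group G] {a b c : G} (ha : a ^ 2 = 1) (hb : b ^ 2 = 1)
    (hc : c ^ 2 = 1) (hac : (a * c) ^ 2 = 1) (hab : (a * b) ^ 3 = 1) (hbc : (b * c) ^ 4 = 1)
    (h : (a * b * c) ^ 3 = 1) :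
    c * a = a * c ∧ b * a * b = a * b * a ∧ c * b * c * b = b * c * b * c ∧
    a * b * a * c * b = c * b * a * c ∧ a * b * c * b * a = b * c * b * c ∧
    a * b * c * b * c = b * c * b * a ∧ a * c * b * a * c = b * a * c * b ∧
    b * a * c * b * a = a * c * b * c ∧ b * a * c * b * c = a * c * b * a ∧
    b * c * b * a * c = a * b * c * b ∧ c * b * a * c * b = a * b * a * c := by
  simp only [pow_succ, pow_zero, one_mul, mul_assoc] at *
  have ha' (x : G) : a * (a * x) = x := by rw [← mul_assoc, ha, one_mul]
  have hb' (x : G) : b * (b * x) = x := by rw [← mul_assoc, hb, one_mul]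
  have hc' (x : G) : c * (c * x) = x := by rw [← mul_assoc, hc, one_mul]
  have hac' (x : G) : a * (c * (a * (c * x))) = x := by
    simpa [mul_assoc] using congrArg (· * x) hac
  have hab' (x : G) : a * (b * (a * (b * (a * (b * x))))) = x := by
    simpa [mul_assoc] using congrArg (· * x) hab
  have hbc' (x : G) : b * (c * (b * (c * (b * (c * (b * (c * x))))))) = x := by
    simpa [mul_assoc] using congrArg (· * x) hbc
  have h' (x : G) : a * (b * (c * (a * (b * (c * (a * (b * (c * x)))))))) = x := by
    simpa [mul_assoc] using congrArg (· * x) h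
  refine ⟨?_, ?_, ?_, ?_, ?_, ?_, ?_, ?_, ?_, ?_, ?_⟩ <;> grind

/-- The consequences of the braid relations among three involutions `a`, `b`, `c` in which `a`
and `c` commute. -/
theorem rewriting_identities_of_braid {G : Type*} [Group G] {a b c : G} (ha : a ^ 2 = 1)
    (hc : c ^ 2 = 1) (hac : (a * c) ^ 2 = 1)
    (hab : b * a * b = a * b * a) (hcb : b * c * b = c * b * c) :
    c * a = a * c ∧ b * a * c * b * a = c * b * a * c * b ∧
    b * a * c * b * c = a * b * a * c * b := by
  have hca : c * a = a * c := by
    rw [pow_two] at ha hc hac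
    rw [← inv_eq_of_mul_eq_one_left hac, mul_inv_rev, inv_eq_of_mul_eq_one_left ha,
      inv_eq_of_mul_eq_one_left hc]
  refine ⟨hca, ?_, ?_⟩
  · calc b * a * c * b * a = b * c * (a * b * a) := by simp only [mul_assoc, ← hca]
      _ = b * c * b * a * b := by rw [← hab]; simp only [mul_assoc]
      _ = c * b * (c * a) * b := by rw [hcb]; simp only [mul_assoc]
      _ = c * b * a * c * b := by rw [hca]; simp only [mul_assoc]
  · calc b * a * c * b * c = b * a * (c * b * c) := by simp only [mul_assoc]
      _ = b * a * b * c * b := by rw [← hcb]; simp only [mul_assoc]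
      _ = a * b * a * c * b := by rw [hab]

theorem pow_mul_comm_eq_one {G : Type*} [Group G] {a b : G} {n : ℕ} (h : (a * b) ^ n = 1) :
    (b * a) ^ n = 1 := by
  rw [show b * a = a⁻¹ * (a * b) * a⁻¹⁻¹ by group, conj_pow, h, mul_one, mul_inv_cancel]

/-- A word in the generators, evaluated in the tomotope group. -/
def evalWord (w : List (Fin 4)) : PresentedGroup tomotopeRels :=
  (w.map PresentedGroup.of).prod

theorem evalWord_cons (i : Fin 4) (w : List (Fin 4)) :
    evalWord (i :: w) = PresentedGroup.of i * evalWord w := by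
  simp [evalWord]

theorem evalWord_append (v w : List (Fin 4)) :
    evalWord (v ++ w) = evalWord v * evalWord w := by
  simp [evalWord]

/-- Rewriting rules that are complete on words omitting at least one generator. -/
def rules : List (List (Fin 4) × List (Fin 4)) :=
  [([0, 0], []), ([1, 1], []), ([2, 0], [0, 2]), ([2, 2], []), ([3, 0], [0, 3]), ([3, 2], [2, 3]),
   ([3, 3], []), ([1, 0, 1], [0, 1, 0]), ([1, 2, 1], [2, 1, 2]), ([3, 1, 3, 1], [1, 3, 1, 3]),
   ([0, 1, 0, 3, 1], [3, 1, 0, 3]), ([0, 1, 3, 1, 0], [1, 3, 1, 3]),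
   ([0, 1, 3, 1, 3], [1, 3, 1, 0]), ([0, 3, 1, 0, 3], [1, 0, 3, 1]),
   ([1, 0, 2, 1, 0], [2, 1, 0, 2, 1]), ([1, 0, 2, 1, 2], [0, 1, 0, 2, 1]),
   ([1, 0, 3, 1, 0], [0, 3, 1, 3]), ([1, 0, 3, 1, 3], [0, 3, 1, 0]),
   ([1, 2, 3, 1, 2], [2, 3, 1, 3]), ([1, 2, 3, 1, 3], [2, 3, 1, 2]),
   ([1, 3, 1, 0, 3], [0, 1, 3, 1]), ([1, 3, 1, 2, 3], [2, 1, 3, 1]),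
   ([2, 1, 2, 3, 1], [3, 1, 2, 3]), ([2, 1, 3, 1, 2], [1, 3, 1, 3]),
   ([2, 1, 3, 1, 3], [1, 3, 1, 2]), ([2, 3, 1, 2, 3], [1, 2, 3, 1]),
   ([3, 1, 0, 3, 1], [0, 1, 0, 3]), ([3, 1, 2, 3, 1], [2, 1, 2, 3])]

theorem evalWord_eq_of_mem_rules :
    ∀ r ∈ rules, evalWord r.1 = evalWord r.2 := by
  have h : ∀ x ∈ tomotopeRels, PresentedGroup.mk tomotopeRels x = 1 :=
    fun x hx => PresentedGroup.one_of_mem hx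
  have hρ (i : Fin 4) : PresentedGroup.mk tomotopeRels (ρ i) = PresentedGroup.of i := rfl
  simp only [forall_mem_tomotopeRels, map_pow, map_mul, hρ] at h
  obtain ⟨h0, h1, h2, h3, h02, h03, h23, h01, h12, h13, h013, h213⟩ := h
  have h21 := pow_mul_comm_eq_one h12
  have k0 := rewriting_identities h0 h1 h3 h03 h01 h13 h013
  have k2 := rewriting_identities h2 h1 h3 h23 h21 h13 h213
  have k02 := rewriting_identities_of_braid h0 h2 h02 k0.2.1 k2.2.1
  simp only [pow_two] at h0 h1 h2 h3
  simp only [rules, evalWord, List.forall_mem_cons, List.map_cons, List.map_nil, List.prod_cons,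
    List.prod_nil, mul_one, ← mul_assoc]
  simp [*]

/-- Prepend a letter to a word, rewriting at the head up to depth `n`. -/
def prepend : ℕ → Fin 4 → List (Fin 4) → List (Fin 4)
  | 0, i, w => i :: w
  | n + 1, i, w =>
    match rules.find? fun r => r.1.isPrefixOf (i :: w) with
    | none => i :: w
    | some r => r.2.foldr (prepend n) ((i :: w).drop r.1.length)

theorem evalWord_prepend (n : ℕ) (i : Fin 4) (w : List (Fin 4)) :
    evalWord (prepend n i w) = evalWord (i :: w) := by
  induction n generalizing i w with
  | zero => rfl
  | succ n ih =>
    have h_foldr (u v : List (Fin 4)) :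
        evalWord (u.foldr (prepend n) v) = evalWord u * evalWord v := by
      induction u with
      | nil => simp [evalWord]
      | cons j u ihu => rw [List.foldr_cons, ih, evalWord_cons, ihu, evalWord_cons, mul_assoc]
    rw [prepend]
    split
    · rfl
    · next r hr =>
      have hp : r.1.isPrefixOf (i :: w) := by simpa only using List.find?_some hr
      obtain ⟨t, ht⟩ := List.isPrefixOf_iff_prefix.mp hp
      rw [h_foldr, ← ht, List.drop_left, evalWord_append,
        evalWord_eq_of_mem_rules r (List.mem_of_find?_eq_some hr)]

/-- The normal forms of the elements lying in some subgroup generated by at most three of the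
generators. -/
def normalForms : List (List (Fin 4)) :=
  [[], [0], [1], [2], [3], [0, 1], [0, 2], [0, 3], [1, 0], [1, 2], [1, 3], [2, 1], [2, 3], [3, 1],
   [0, 1, 0], [0, 1, 2], [0, 1, 3], [0, 2, 1], [0, 2, 3], [0, 3, 1], [1, 0, 2], [1, 0, 3],
   [1, 2, 3], [1, 3, 1], [2, 1, 0], [2, 1, 2], [2, 1, 3], [2, 3, 1], [3, 1, 0], [3, 1, 2],
   [3, 1, 3], [0, 1, 0, 2], [0, 1, 0, 3], [0, 1, 3, 1], [0, 2, 1, 0], [0, 2, 1, 2], [0, 3, 1, 0],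
   [0, 3, 1, 3], [1, 0, 2, 1], [1, 0, 3, 1], [1, 2, 3, 1], [1, 3, 1, 0], [1, 3, 1, 2],
   [1, 3, 1, 3], [2, 1, 0, 2], [2, 1, 2, 3], [2, 1, 3, 1], [2, 3, 1, 2], [2, 3, 1, 3],
   [3, 1, 0, 3], [3, 1, 2, 3], [0, 1, 0, 2, 1], [0, 2, 1, 0, 2], [2, 1, 0, 2, 1],
   [0, 2, 1, 0, 2, 1]]

theorem prepend_mem :
    ∀ w ∈ normalForms, ∀ i : Fin 4, (∃ j, j ∉ i :: w) →
      prepend 4 i w ∈ normalForms ∧ prepend 4 i w ⊆ i :: w := by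
  decide +kernel

/-- The images of the generators under a permutation representation of degree `8`. -/
def generatorPerm : Fin 4 → Equiv.Perm (Fin 8) :=
  ![c[0, 1] * c[2, 3] * c[4, 5] * c[6, 7], c[0, 4] * c[1, 2] * c[3, 5] * c[6, 7],
    c[0, 3] * c[1, 2] * c[4, 7] * c[5, 6], c[0, 5] * c[1, 4] * c[2, 7] * c[3, 6]]

theorem lift_generatorPerm_eq_one :
    ∀ r ∈ tomotopeRels, FreeGroup.lift generatorPerm r = 1 := by
  simp only [forall_mem_tomotopeRels, ρ, map_pow, map_mul, FreeGroup.lift_apply_of]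
  decide +kernel

/-- The permutation representation of degree `8` of the tomotope group. -/
def permRep : PresentedGroup tomotopeRels →* Equiv.Perm (Fin 8) :=
  PresentedGroup.toGroup lift_generatorPerm_eq_one

theorem permRep_evalWord (w : List (Fin 4)) :
    permRep (evalWord w) = (w.map generatorPerm).prod := by
  simp [evalWord, permRep, map_list_prod, Function.comp_def]

theorem prod_map_generatorPerm_injOn :
    ∀ v ∈ normalForms, ∀ w ∈ normalForms,
      (v.map generatorPerm).prod = (w.map generatorPerm).prod → v = w := by
  decide +kernel

theorem evalWord_injOn {v w : List (Fin 4)} (hv : v ∈ normalForms) (hw : w ∈ normalForms)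
    (h : evalWord v = evalWord w) : v = w :=
  prod_map_generatorPerm_injOn v hv w hw <| by
    rw [← permRep_evalWord, ← permRep_evalWord, h]

theorem of_inv (i : Fin 4) :
    (PresentedGroup.of i : PresentedGroup tomotopeRels)⁻¹ = PresentedGroup.of i := by
  have h := evalWord_eq_of_mem_rules ([i, i], []) (by revert i; decide)
  exact inv_eq_of_mul_eq_one_left (by simpa [evalWord] using h)

theorem exists_normalForm {I : Set (Fin 4)} (hI : I ≠ Set.univ)
    {x : PresentedGroup tomotopeRels}
    (hx : x ∈ Subgroup.closure
      ((PresentedGroup.of : Fin 4 → PresentedGroup tomotopeRels) '' I)) :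
    ∃ w ∈ normalForms, (∀ i ∈ w, i ∈ I) ∧ evalWord w = x := by
  obtain ⟨j, hj⟩ := (Set.ne_univ_iff_exists_notMem I).mp hI
  have step (i : Fin 4) (hi : i ∈ I) (y : PresentedGroup tomotopeRels) :
      (∃ w ∈ normalForms, (∀ i ∈ w, i ∈ I) ∧ evalWord w = y) →
        ∃ w ∈ normalForms, (∀ i ∈ w, i ∈ I) ∧ evalWord w = PresentedGroup.of i * y := by
    rintro ⟨w, hw, hwI, rfl⟩
    have hiw : ∀ k ∈ i :: w, k ∈ I := List.forall_mem_cons.mpr ⟨hi, hwI⟩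
    obtain ⟨hmem, hsub⟩ := prepend_mem w hw i ⟨j, fun h => hj (hiw j h)⟩
    exact ⟨_, hmem, fun k hk => hiw k (hsub hk), by rw [evalWord_prepend, evalWord_cons]⟩
  induction hx using Subgroup.closure_induction_left with
  | one => exact ⟨[], by decide, by simp, rfl⟩
  | mul_left x hx y _ ih =>
    obtain ⟨i, hi, rfl⟩ := hx
    exact step i hi y ih
  | inv_mul_cancel x hx y _ ih =>
    obtain ⟨i, hi, rfl⟩ := hx
    rw [of_inv]
    exact step i hi y ih

theorem evalWord_mem_closure {I : Set (Fin 4)} {w : List (Fin 4)} (hw : ∀ i ∈ w, i ∈ I) :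
    evalWord w ∈ Subgroup.closure
      ((PresentedGroup.of : Fin 4 → PresentedGroup tomotopeRels) '' I) := by
  refine Subgroup.list_prod_mem _ fun x hx => ?_
  obtain ⟨i, hi, rfl⟩ := List.mem_map.mp hx
  exact Subgroup.subset_closure ⟨i, hw i hi, rfl⟩

/-- The tomotope group satisfies the intersection condition on its distinguished
generators `ρ₀, ρ₁, ρ₂, ρ₃`: for all subsets `I`, `J` of the index set,
`⟨I⟩ ∩ ⟨J⟩ = ⟨I ∩ J⟩`. -/
theorem tomotope_intersection_condition :
    ∀ I J : Set (Fin 4),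
      Subgroup.closure ((PresentedGroup.of : Fin 4 → PresentedGroup tomotopeRels) '' I)
          ⊓ Subgroup.closure ((PresentedGroup.of : Fin 4 → PresentedGroup tomotopeRels) '' J)
        = Subgroup.closure
            ((PresentedGroup.of : Fin 4 → PresentedGroup tomotopeRels) '' (I ∩ J)) := by
  intro I J
  refine le_antisymm ?_ (le_inf
    (Subgroup.closure_mono (Set.image_mono Set.inter_subset_left))
    (Subgroup.closure_mono (Set.image_mono Set.inter_subset_right)))
  rintro x ⟨hxI, hxJ⟩
  rcases eq_or_ne I Set.univ with rfl | hI
  · rwa [Set.univ_inter]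
  rcases eq_or_ne J Set.univ with rfl | hJ
  · rwa [Set.inter_univ]
  obtain ⟨v, hv, hvI, rfl⟩ := exists_normalForm hI hxI
  obtain ⟨w, hw, hwJ, hwv⟩ := exists_normalForm hJ hxJ
  obtain rfl := evalWord_injOn hw hv hwv
  exact evalWord_mem_closure fun i hi => ⟨hvI i hi, hwJ i hi⟩

end Tomotope
end

section
/- In the symmetric group on {1, …, 7}, the subgroup generated by the three permutations α_1 = (2 3)(4 5), α_0 = (1 2), and β_1 = (2 4)(3 5)(6 7) has order 240. Moreover each generator is an involution and both products α_0α_1 and α_0β_1 have order 6. -/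
namespace Census66

/-- `α₁ = (2 3)(4 5)` on `{1, …, 7}`, zero-indexed as a permutation of `Fin 7`. -/
def α₁ : Equiv.Perm (Fin 7) := Equiv.swap 1 2 * Equiv.swap 3 4

/-- `α₀ = (1 2)` on `{1, …, 7}`, zero-indexed. -/
def α₀ : Equiv.Perm (Fin 7) := Equiv.swap 0 1

/-- `β₁ = (2 4)(3 5)(6 7)` on `{1, …, 7}`, zero-indexed. -/
def β₁ : Equiv.Perm (Fin 7) := Equiv.swap 1 3 * Equiv.swap 2 4 * Equiv.swap 5 6

/-- The embedding of `S₅ × S₂` in `S₇` acting on the first five and the last two points. -/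
def youngHom : Equiv.Perm (Fin 5) × Equiv.Perm (Fin 2) →* Equiv.Perm (Fin 7) :=
  (finSumFinEquiv (m := 5) (n := 2)).permCongrHom.toMonoidHom.comp
    (Equiv.Perm.sumCongrHom (Fin 5) (Fin 2))

theorem youngHom_injective : Function.Injective youngHom :=
  (finSumFinEquiv (m := 5) (n := 2)).permCongrHom.injective.comp
    Equiv.Perm.sumCongrHom_injective

theorem conj_swap_mem {ι : Type*} [DecidableEq ι] {H : Subgroup (Equiv.Perm ι)}
    {g : Equiv.Perm ι} (hg : g ∈ H) {a b : ι} (h : Equiv.swap a b ∈ H) :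
    Equiv.swap (g a) (g b) ∈ H := by
  rw [Equiv.swap_apply_apply]
  exact H.mul_mem (H.mul_mem hg h) (H.inv_mem hg)

theorem swap_triple_mem {ι : Type*} [DecidableEq ι] {H : Subgroup (Equiv.Perm ι)} {a b c : ι}
    (hac : a ≠ c) (hbc : b ≠ c) (hb : Equiv.swap a b ∈ H) (hc : Equiv.swap a c ∈ H) :
    Equiv.swap b c ∈ H := by
  simpa [Equiv.swap_apply_of_ne_of_ne hac.symm hbc.symm] using conj_swap_mem hb hc

theorem closure_eq_range_youngHom :
    Subgroup.closure ({α₁, α₀, β₁} : Set (Equiv.Perm (Fin 7))) = youngHom.range := by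
  apply le_antisymm
  · rw [Subgroup.closure_le]
    rintro _ (rfl | rfl | rfl)
    · exact ⟨(Equiv.swap 1 2 * Equiv.swap 3 4, 1), by decide⟩
    · exact ⟨(Equiv.swap 0 1, 1), by decide⟩
    · exact ⟨(Equiv.swap 1 3 * Equiv.swap 2 4, Equiv.swap 0 1), by decide⟩
  set H := Subgroup.closure ({α₁, α₀, β₁} : Set (Equiv.Perm (Fin 7)))
  have hα₁ : α₁ ∈ H := Subgroup.subset_closure (by simp)
  have h01 : Equiv.swap 0 1 ∈ H := Subgroup.subset_closure (by simp [α₀])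
  have hβ₁ : β₁ ∈ H := Subgroup.subset_closure (by simp)
  have h02 : Equiv.swap 0 2 ∈ H := conj_swap_mem hα₁ h01
  have h03 : Equiv.swap 0 3 ∈ H := conj_swap_mem hβ₁ h01
  have h04 : Equiv.swap 0 4 ∈ H := conj_swap_mem hβ₁ h02
  have h12 : Equiv.swap 1 2 ∈ H := swap_triple_mem (by decide) (by decide) h01 h02
  have h13 : Equiv.swap 1 3 ∈ H := swap_triple_mem (by decide) (by decide) h01 h03
  have h23 : Equiv.swap 2 3 ∈ H := swap_triple_mem (by decide) (by decide) h02 h03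
  have h24 : Equiv.swap 2 4 ∈ H := swap_triple_mem (by decide) (by decide) h02 h04
  have h34 : Equiv.swap 3 4 ∈ H := swap_triple_mem (by decide) (by decide) h03 h04
  have h56 : Equiv.swap 5 6 ∈ H := (H.mul_mem_cancel_left (H.mul_mem h13 h24)).mp hβ₁
  have hleft (σ : Equiv.Perm (Fin 5)) : youngHom (σ, 1) ∈ H := by
    have hσ : σ ∈ Submonoid.closure
        (Set.range fun i : Fin 4 ↦ Equiv.swap i.castSucc i.succ) := by
      rw [Equiv.Perm.mclosure_swap_castSucc_succ]
      trivial
    induction hσ using Submonoid.closure_induction with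
    | one => exact (map_one youngHom).symm ▸ H.one_mem
    | mul x y _ _ hx hy =>
      have hxy : youngHom (x * y, 1) = youngHom (x, 1) * youngHom (y, 1) := by
        rw [← map_mul, Prod.mk_mul_mk, one_mul]
      exact hxy ▸ H.mul_mem hx hy
    | mem x hx =>
      obtain ⟨i, rfl⟩ := hx
      have key : youngHom (Equiv.swap i.castSucc i.succ, 1) =
          Equiv.swap (i.castLE (by decide)) (i.succ.castLE (by decide)) := by
        revert i
        decide
      simp only [key]
      fin_cases i
      exacts [h01, h12, h23, h34]
  have hright (τ : Equiv.Perm (Fin 2)) : youngHom (1, τ) ∈ H := by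
    have hτ : youngHom (1, τ) = 1 ∨ youngHom (1, τ) = Equiv.swap 5 6 := by
      revert τ
      decide
    rcases hτ with h | h <;> rw [h]
    exacts [H.one_mem, h56]
  rintro _ ⟨⟨σ, τ⟩, rfl⟩
  have hστ : youngHom (σ, τ) = youngHom (σ, 1) * youngHom (1, τ) := by
    rw [← map_mul, Prod.mk_mul_mk, one_mul, mul_one]
  exact hστ ▸ H.mul_mem (hleft σ) (hright τ)

theorem orderOf_eq_six {G : Type*} [Monoid G] {g : G} (h : g ^ 6 = 1) (h2 : g ^ 2 ≠ 1)
    (h3 : g ^ 3 ≠ 1) : orderOf g = 6 := by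
  refine orderOf_eq_of_pow_and_pow_div_prime (by decide) h fun p hp hd ↦ ?_
  rcases hp.dvd_mul.mp (show p ∣ 2 * 3 from hd) with hd | hd
  · rwa [(Nat.prime_dvd_prime_iff_eq hp Nat.prime_two).mp hd]
  · rwa [(Nat.prime_dvd_prime_iff_eq hp Nat.prime_three).mp hd]

/-- The subgroup of the symmetric group on `{1, …, 7}` generated by `α₁`, `α₀`, `β₁`
(the automorphism group of the polyhedron `{6,6}*240a`) has order `240`; each generator
is an involution and the products `α₀α₁` and `α₀β₁` both have order `6`. -/
theorem census_240_group :
    Nat.card (Subgroup.closure ({α₁, α₀, β₁} : Set (Equiv.Perm (Fin 7)))) = 240 ∧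
    orderOf α₁ = 2 ∧ orderOf α₀ = 2 ∧ orderOf β₁ = 2 ∧
    orderOf (α₀ * α₁) = 6 ∧ orderOf (α₀ * β₁) = 6 := by
  refine ⟨?_, orderOf_eq_prime (by decide) (by decide), orderOf_eq_prime (by decide) (by decide),
    orderOf_eq_prime (by decide) (by decide), orderOf_eq_six (by decide) (by decide) (by decide),
    orderOf_eq_six (by decide) (by decide) (by decide)⟩
  rw [closure_eq_range_youngHom,
    ← Nat.card_congr (MonoidHom.ofInjective youngHom_injective).toEquiv, Nat.card_prod,
    Nat.card_perm, Nat.card_perm, Nat.card_fin, Nat.card_fin]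
  rfl

end Census66
end
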